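/- (Left twist Chamber Ansatz, inverse form, type A.) In the Marsh–Rietsch setup over ℂ with all parameters t_r ≠ 0: let g∩ ∈ SL(n,ℂ) be a matrix such that g∩·v̇⁻¹ ∈ N, v̇⁻¹·g∩ ∈ N, and g∩ = g·b for some b ∈ B₋ (such a g∩ exists and is unique). Then ẇ·g∩ᵀ admits an LDU factorization; set y⃖ := [ẇg∩ᵀ]_R^+. For every j ∈ {1,…,m}: Δ^{R_j}_{C_j}(y⃖) = ∏_{r ∈ J°, r ≤ j} t_r^{−([q'_{j,r}(i_r) ≤ i_j] − [q'_{j,r}(i_r+1) ≤ i_j])}, where R_j := (s_{i_1}∘s_{i_2}∘···∘s_{i_j})({i_j+1,…,n}), C_j := (s^v_{i_1}∘s^v_{i_2}∘···∘s^v_{i_j})({i_j+1,…,n}), and q'_{j,r} := s_{i_j}∘s_{i_{j−1}}∘···∘s_{i_{r+1}} (the empty composition, for r = j, being the identity permutation). -/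

import Mathlib

open Matrix Finset

namespace Paper

open scoped Classical

noncomputable section

variable {K : Type*} [Field K] {n m : ℕ}

/-- `N`: upper unitriangular matrices. -/
def IsN (g : Matrix (Fin n) (Fin n) K) : Prop :=
  (∀ i, g i i = 1) ∧ ∀ i j : Fin n, j < i → g i j = 0

/-- `N₋`: lower unitriangular matrices. -/
def IsNm (g : Matrix (Fin n) (Fin n) K) : Prop :=
  (∀ i, g i i = 1) ∧ ∀ i j : Fin n, i < j → g i j = 0

/-- `B`: upper triangular matrices of determinant 1. -/
def IsB (g : Matrix (Fin n) (Fin n) K) : Prop :=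
  g.det = 1 ∧ ∀ i j : Fin n, j < i → g i j = 0

/-- `B₋`: lower triangular matrices of determinant 1. -/
def IsBm (g : Matrix (Fin n) (Fin n) K) : Prop :=
  g.det = 1 ∧ ∀ i j : Fin n, i < j → g i j = 0

/-- `H`: diagonal matrices of determinant 1. -/
def IsH (g : Matrix (Fin n) (Fin n) K) : Prop :=
  g.det = 1 ∧ ∀ i j : Fin n, i ≠ j → g i j = 0

/-- UDL factorization: `g = yp * y0 * ym` with `yp ∈ N`, `y0 ∈ H`, `ym ∈ N₋`. -/
def UDL (g yp y0 ym : Matrix (Fin n) (Fin n) K) : Prop :=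
  IsN yp ∧ IsH y0 ∧ IsNm ym ∧ g = yp * y0 * ym

/-- LDU factorization: `g = zm * z0 * zp` with `zm ∈ N₋`, `z0 ∈ H`, `zp ∈ N`. -/
def LDU (g zm z0 zp : Matrix (Fin n) (Fin n) K) : Prop :=
  IsNm zm ∧ IsH z0 ∧ IsN zp ∧ g = zm * z0 * zp

/-- The signed permutation matrix `v̇`. -/
def pdot (v : Equiv.Perm (Fin n)) : Matrix (Fin n) (Fin n) K :=
  Matrix.of fun a b : Fin n =>
    if a = v b then
      (-1 : K) ^ (univ.filter fun k : Fin n => b < k ∧ v k < v b).card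
    else 0

/-- Membership in the double coset `B₋ w B₋`. -/
def InBmWBm (w : Equiv.Perm (Fin n)) (g : Matrix (Fin n) (Fin n) K) : Prop :=
  ∃ b₁ b₂ : Matrix (Fin n) (Fin n) K, IsBm b₁ ∧ IsBm b₂ ∧ g = b₁ * pdot w * b₂

/-- `Δ^I_J(g)`: the minor with row set `I` and column set `J` (junk value 0 if sizes differ). -/
def minor (g : Matrix (Fin n) (Fin n) K) (I J : Finset (Fin n)) : K :=
  if h : I.card = J.card then
    Matrix.det (Matrix.of fun a b : Fin I.card =>
      g (I.orderEmbOfFin rfl a) (J.orderEmbOfFin h.symm b))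
  else 0

/-- All right-aligned flag minors of `g` are nonnegative. -/
def RightFlagNonneg (g : Matrix (Fin n) (Fin n) ℝ) : Prop :=
  ∀ I : Finset (Fin n),
    0 ≤ minor g I (univ.filter fun j : Fin n => n - I.card ≤ (j : ℕ))

/-- All top-aligned flag minors of `g` are nonnegative. -/
def TopFlagNonneg (g : Matrix (Fin n) (Fin n) ℝ) : Prop :=
  ∀ J : Finset (Fin n),
    0 ≤ minor g (univ.filter fun i : Fin n => (i : ℕ) < J.card) J

/-- `x_i(t)` (with 1-based `i`): `Id + t·E_{i,i+1}`. -/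
def xmat (i : ℕ) (t : K) : Matrix (Fin n) (Fin n) K :=
  Matrix.of fun a b : Fin n =>
    if a = b then 1 else if (a : ℕ) + 1 = i ∧ (b : ℕ) = i then t else 0

/-- `y_i(t)` (with 1-based `i`): `Id + t·E_{i+1,i}`. -/
def ymat (i : ℕ) (t : K) : Matrix (Fin n) (Fin n) K :=
  Matrix.of fun a b : Fin n =>
    if a = b then 1 else if (a : ℕ) = i ∧ (b : ℕ) + 1 = i then t else 0

/-- `ṡ_i` (with 1-based `i`). -/
def sdot (i : ℕ) : Matrix (Fin n) (Fin n) K :=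
  Matrix.of fun a b : Fin n =>
    if (a : ℕ) + 1 = i ∧ (b : ℕ) = i then 1
    else if (a : ℕ) = i ∧ (b : ℕ) + 1 = i then -1
    else if a = b ∧ (a : ℕ) + 1 ≠ i ∧ (a : ℕ) ≠ i then 1
    else 0

/-- The adjacent transposition `s_i` (with 1-based `i`); identity if out of range. -/
def sperm (n : ℕ) (i : ℕ) : Equiv.Perm (Fin n) :=
  if h : i < n then
    Equiv.swap ⟨i - 1, Nat.lt_of_le_of_lt (Nat.sub_le i 1) h⟩ ⟨i, h⟩
  else 1

/-- `ℓ(w)`: the number of inversions of `w`. -/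
def len (w : Equiv.Perm (Fin n)) : ℕ :=
  (univ.filter fun p : Fin n × Fin n => p.1 < p.2 ∧ w p.2 < w p.1).card

/-- `vseq ii v k = v_{(m-k)}`: the rightmost (positive distinguished) subexpression recursion. -/
def vseq (ii : Fin m → ℕ) (v : Equiv.Perm (Fin n)) : ℕ → Equiv.Perm (Fin n)
  | 0 => v
  | k + 1 =>
    if h : m - k - 1 < m then
      if len (vseq ii v k * sperm n (ii ⟨m - k - 1, h⟩)) < len (vseq ii v k) then
        vseq ii v k * sperm n (ii ⟨m - k - 1, h⟩)
      else vseq ii v k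
    else vseq ii v k

/-- `r ∈ J°` (0-based `r`, corresponding to the 1-based index `r+1`). -/
def inJ (ii : Fin m → ℕ) (v : Equiv.Perm (Fin n)) (r : Fin m) : Prop :=
  vseq ii v (m - (r : ℕ)) = vseq ii v (m - (r : ℕ) - 1)

/-- The list `[s_{i_1}, …, s_{i_m}]` of adjacent transpositions. -/
def sPermList (n : ℕ) (ii : Fin m → ℕ) : List (Equiv.Perm (Fin n)) :=
  List.ofFn fun r => sperm n (ii r)

/-- The list `[s^v_{i_1}, …, s^v_{i_m}]`. -/
def svPermList (ii : Fin m → ℕ) (v : Equiv.Perm (Fin n)) : List (Equiv.Perm (Fin n)) :=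
  List.ofFn fun r => if inJ ii v r then 1 else sperm n (ii r)

/-- The factors `g_1, …, g_m` of the Marsh–Rietsch element. -/
def mrgList (ii : Fin m → ℕ) (v : Equiv.Perm (Fin n)) (t : Fin m → K) :
    List (Matrix (Fin n) (Fin n) K) :=
  List.ofFn fun r => if inJ ii v r then xmat (ii r) (t r) else sdot (ii r)

/-- The Marsh–Rietsch element `g = g_1 ⋯ g_m`. -/
def mrg (ii : Fin m → ℕ) (v : Equiv.Perm (Fin n)) (t : Fin m → K) :
    Matrix (Fin n) (Fin n) K :=
  (mrgList ii v t).prod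

/-- The list `[ṡ_{i_1}, …, ṡ_{i_m}]`. -/
def sdotList (n : ℕ) (ii : Fin m → ℕ) : List (Matrix (Fin n) (Fin n) K) :=
  List.ofFn fun r => sdot (ii r)

/-- `ẇ = ṡ_{i_1} ⋯ ṡ_{i_m}`. -/
def wMR (n : ℕ) (ii : Fin m → ℕ) : Matrix (Fin n) (Fin n) K :=
  (sdotList n ii).prod

section helpers

abbrev Mat (n : ℕ) := Matrix (Fin n) (Fin n) ℂ

lemma sperm_eq {n i : ℕ} {p q : Fin n} (hp : (p : ℕ) + 1 = i) (hq : (q : ℕ) = i) :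
    sperm n i = Equiv.swap p q := by
  have h : i < n := hq ▸ q.2
  rw [sperm, dif_pos h]
  congr 1 <;> ext <;> simp <;> omega

lemma mul_sdot {n i : ℕ} {p q : Fin n} (hp : (p : ℕ) + 1 = i) (hq : (q : ℕ) = i) (M : Mat n)
    (a b : Fin n) :
    (M * sdot i : Mat n) a b = if b = p then - M a q else if b = q then M a p else M a b := by
  have hpq : p ≠ q := by intro h; rw [h] at hp; omega
  rw [Matrix.mul_apply]
  have key : ∀ c : Fin n, (sdot i : Mat n) c b =
      if b = p then (if c = q then -1 else 0) else if b = q then (if c = p then 1 else 0)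
      else (if c = b then 1 else 0) := by
    intro c
    simp only [sdot, Matrix.of_apply, Fin.ext_iff]
    grind
  simp only [key]
  split_ifs with h1 h2
  · simp
  · simp
  · simp

lemma mul_xmat {n i : ℕ} {p q : Fin n} (hp : (p : ℕ) + 1 = i) (hq : (q : ℕ) = i) (M : Mat n)
    (t : ℂ) (a b : Fin n) :
    (M * xmat i t : Mat n) a b = if b = q then M a q + t * M a p else M a b := by
  have hpq : p ≠ q := by intro h; rw [h] at hp; omega
  rw [Matrix.mul_apply]
  have key : ∀ c : Fin n, (xmat i t : Mat n) c b =
      (if c = b then 1 else 0) + if b = q then (if c = p then t else 0) else 0 := by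
    intro c
    simp only [xmat, Matrix.of_apply, Fin.ext_iff]
    grind
  simp only [key, mul_add, Finset.sum_add_distrib]
  split_ifs with h1
  · subst h1; simp [mul_comm]
  · simp

lemma sdot_mul {n i : ℕ} {p q : Fin n} (hp : (p : ℕ) + 1 = i) (hq : (q : ℕ) = i) (M : Mat n)
    (a b : Fin n) :
    (sdot i * M : Mat n) a b = if a = p then M q b else if a = q then - M p b else M a b := by
  have hpq : p ≠ q := by intro h; rw [h] at hp; omega
  rw [Matrix.mul_apply]
  have key : ∀ c : Fin n, (sdot i : Mat n) a c =
      if a = p then (if c = q then 1 else 0) else if a = q then (if c = p then -1 else 0)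
      else (if c = a then 1 else 0) := by
    intro c
    simp only [sdot, Matrix.of_apply, Fin.ext_iff]
    grind
  simp only [key]
  split_ifs with h1 h2
  · simp
  · simp
  · simp

lemma xmat_mul {n i : ℕ} {p q : Fin n} (hp : (p : ℕ) + 1 = i) (hq : (q : ℕ) = i) (M : Mat n)
    (t : ℂ) (a b : Fin n) :
    (xmat i t * M : Mat n) a b = if a = p then M p b + t * M q b else M a b := by
  have hpq : p ≠ q := by intro h; rw [h] at hp; omega
  rw [Matrix.mul_apply]
  have key : ∀ c : Fin n, (xmat i t : Mat n) a c =
      (if c = a then 1 else 0) + if a = p then (if c = q then t else 0) else 0 := by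
    intro c
    simp only [xmat, Matrix.of_apply, Fin.ext_iff]
    grind
  simp only [key, add_mul, Finset.sum_add_distrib]
  split_ifs with h1
  · subst h1; simp [mul_comm]
  · simp

lemma sdotT_mul {n i : ℕ} {p q : Fin n} (hp : (p : ℕ) + 1 = i) (hq : (q : ℕ) = i) (M : Mat n)
    (a b : Fin n) :
    ((sdot i)ᵀ * M : Mat n) a b = if a = p then - M q b else if a = q then M p b else M a b := by
  have := mul_sdot hp hq Mᵀ b a
  rw [← Matrix.transpose_apply (Mᵀ * sdot i), Matrix.transpose_mul, Matrix.transpose_transpose]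
    at this
  simpa using this

lemma mul_sdotT {n i : ℕ} {p q : Fin n} (hp : (p : ℕ) + 1 = i) (hq : (q : ℕ) = i) (M : Mat n)
    (a b : Fin n) :
    (M * (sdot i)ᵀ : Mat n) a b = if b = p then M a q else if b = q then - M a p else M a b := by
  have := sdot_mul hp hq Mᵀ b a
  rw [← Matrix.transpose_apply (sdot i * Mᵀ), Matrix.transpose_mul, Matrix.transpose_transpose]
    at this
  simpa using this

lemma sdot_mul_T {n i : ℕ} (h1 : 1 ≤ i) (h2 : i < n) : (sdot i : Mat n) * (sdot i)ᵀ = 1 := by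
  have hp : ((⟨i - 1, by omega⟩ : Fin n) : ℕ) + 1 = i := by simp; omega
  have hq : ((⟨i, h2⟩ : Fin n) : ℕ) = i := rfl
  ext a b
  rw [sdot_mul hp hq]
  simp only [Matrix.transpose_apply, sdot, Matrix.of_apply, Matrix.one_apply, Fin.ext_iff]
  grind

lemma sdotT_mul_self {n i : ℕ} (h1 : 1 ≤ i) (h2 : i < n) : (sdot i : Mat n)ᵀ * (sdot i) = 1 :=
  mul_eq_one_comm.mp (sdot_mul_T h1 h2)

lemma xmat_mul_neg {n i : ℕ} (h1 : 1 ≤ i) (h2 : i < n) (t : ℂ) :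
    (xmat i t : Mat n) * (xmat i (-t)) = 1 := by
  have hp : ((⟨i - 1, by omega⟩ : Fin n) : ℕ) + 1 = i := by simp; omega
  have hq : ((⟨i, h2⟩ : Fin n) : ℕ) = i := rfl
  ext a b
  rw [xmat_mul hp hq]
  simp only [xmat, Matrix.of_apply, Matrix.one_apply, Fin.ext_iff]
  grind

lemma len_mul_swap {n : ℕ} {p q : Fin n} (hpq : (p : ℕ) + 1 = q) (u : Equiv.Perm (Fin n))
    (h : u p < u q) : len (u * Equiv.swap p q) = len u + 1 := by
  have hne : p ≠ q := by intro h; rw [h] at hpq; omega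
  have key : (univ.filter fun x : Fin n × Fin n =>
      x.1 < x.2 ∧ (u * Equiv.swap p q) x.2 < (u * Equiv.swap p q) x.1) =
      insert (p, q) ((univ.filter fun x : Fin n × Fin n => x.1 < x.2 ∧ u x.2 < u x.1).image
        (fun x => (Equiv.swap p q x.1, Equiv.swap p q x.2))) := by
    ext ⟨a, b⟩
    simp only [mem_filter, mem_univ, true_and, mem_insert, mem_image, Prod.mk.injEq, Prod.exists]
    simp only [Equiv.Perm.mul_apply]
    have ex : (∃ c d, (c < d ∧ u d < u c) ∧ Equiv.swap p q c = a ∧ Equiv.swap p q d = b) ↔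
        (Equiv.swap p q a < Equiv.swap p q b ∧ u (Equiv.swap p q b) < u (Equiv.swap p q a)) := by
      constructor
      · rintro ⟨c, d, h, rfl, rfl⟩; simpa using h
      · intro h; exact ⟨_, _, h, by simp, by simp⟩
    rw [ex]
    have h' : ¬ (u q < u p) := not_lt.mpr h.le
    by_cases hab : a = p ∧ b = q
    · obtain ⟨rfl, rfl⟩ := hab
      have : a < b := by rw [Fin.lt_def]; omega
      simp [h, this]
    · by_cases hba : a = q ∧ b = p
      · obtain ⟨rfl, rfl⟩ := hba
        have : ¬ (a < b) := by rw [Fin.lt_def]; omega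
        simp [h', this, hne]
      · simp only [hab, false_or]
        have : a < b ↔ Equiv.swap p q a < Equiv.swap p q b := by
          simp only [Equiv.swap_apply_def, Fin.lt_def]
          simp only [Fin.ext_iff] at *
          split_ifs <;> omega
        rw [this]
  rw [len, key, card_insert_of_notMem, card_image_of_injective, len]
  · rintro ⟨a, b⟩ ⟨c, d⟩; simp
  · simp only [mem_image, not_exists, mem_filter, mem_univ, true_and, Prod.exists, Prod.mk.injEq,
      not_and]
    rintro a b ⟨h1, h2⟩ h3 h4
    have ha : a = q := by rw [← Equiv.swap_apply_left p q] at h3 ; simpa using congrArg (Equiv.swap p q) h3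
    have hb : b = p := by simpa using congrArg (Equiv.swap p q) h4
    subst ha hb
    simp only [Fin.lt_def] at h1; omega

lemma len_mul_swap' {n : ℕ} {p q : Fin n} (hpq : (p : ℕ) + 1 = q) (u : Equiv.Perm (Fin n))
    (h : u q < u p) : len (u * Equiv.swap p q) + 1 = len u := by
  have := len_mul_swap hpq (u * Equiv.swap p q) (by simpa using h)
  rw [← this, mul_assoc]; simp

lemma lt_of_not {n : ℕ} {p q : Fin n} (hpq : (p : ℕ) + 1 = q) (u : Equiv.Perm (Fin n))
    (h : ¬ (u p < u q)) : u q < u p := by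
  refine lt_of_le_of_ne (not_lt.mp h) ?_
  intro h; have := u.injective h; rw [this] at hpq; omega

def eps {n : ℕ} (v : Equiv.Perm (Fin n)) (d : Fin n) : ℂ :=
  ∏ b ∈ Finset.Ioi d, if v d < v b then (1 : ℂ) else -1

lemma eps_sq {n : ℕ} (v : Equiv.Perm (Fin n)) (d : Fin n) : eps v d * eps v d = 1 := by
  rw [eps, ← Finset.prod_mul_distrib]
  apply Finset.prod_eq_one
  intros; split_ifs <;> simp

lemma Ioi_p {n : ℕ} {p q : Fin n} (hpq : (p : ℕ) + 1 = q) :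
    Finset.Ioi p = insert q (Finset.Ioi q) := by
  ext a; simp only [Finset.mem_Ioi, Finset.mem_insert, Fin.lt_def, Fin.ext_iff]; omega

lemma eps_swap_q {n : ℕ} {p q : Fin n} (hpq : (p : ℕ) + 1 = q) (v : Equiv.Perm (Fin n))
    (h : v p < v q) : eps (v * Equiv.swap p q) q = eps v p := by
  rw [eps, eps, Ioi_p hpq, Finset.prod_insert (by simp), if_pos h, one_mul]
  apply Finset.prod_congr rfl
  intro b hb
  have h1 : b ≠ q := by rintro rfl; simp at hb
  have h2 : b ≠ p := by rintro rfl; simp only [Finset.mem_Ioi, Fin.lt_def] at hb; omega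
  simp [Equiv.swap_apply_of_ne_of_ne h2 h1]

lemma eps_swap_p {n : ℕ} {p q : Fin n} (hpq : (p : ℕ) + 1 = q) (v : Equiv.Perm (Fin n))
    (h : v p < v q) : eps (v * Equiv.swap p q) p = - eps v q := by
  rw [eps, eps, Ioi_p hpq, Finset.prod_insert (by simp), if_neg (by simpa using h.le),
    neg_one_mul]
  congr 1
  apply Finset.prod_congr rfl
  intro b hb
  have h1 : b ≠ q := by rintro rfl; simp at hb
  have h2 : b ≠ p := by rintro rfl; simp only [Finset.mem_Ioi, Fin.lt_def] at hb; omega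
  simp [Equiv.swap_apply_of_ne_of_ne h2 h1]

lemma eps_swap_ne {n : ℕ} {p q : Fin n} (hpq : (p : ℕ) + 1 = q) (v : Equiv.Perm (Fin n))
    (d : Fin n) (h1 : d ≠ p) (h2 : d ≠ q) : eps (v * Equiv.swap p q) d = eps v d := by
  rw [eps, eps]
  apply Finset.prod_equiv (Equiv.swap p q)
  · intro i
    simp only [Finset.mem_Ioi, Equiv.swap_apply_def, Fin.lt_def]
    simp only [ne_eq, Fin.ext_iff] at *
    split_ifs <;> omega
  · intro i _
    simp [Equiv.swap_apply_of_ne_of_ne h1 h2]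

def Wn (n : ℕ) (i : ℕ → ℕ) (J : ℕ → Prop) : ℕ → Equiv.Perm (Fin n)
  | 0 => 1
  | k + 1 => Wn n i J k * (if J k then 1 else sperm n (i k))

def Gn (n : ℕ) (i : ℕ → ℕ) (J : ℕ → Prop) (t : ℕ → ℂ) : ℕ → Mat n
  | 0 => 1
  | k + 1 => Gn n i J t k * (if J k then xmat (i k) (t k) else sdot (i k))

lemma Gn_struct {n m : ℕ} (i : ℕ → ℕ) (J : ℕ → Prop) (t : ℕ → ℂ)
    (hi : ∀ k < m, 1 ≤ i k ∧ i k < n)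
    (hW : ∀ k < m, ∀ p q : Fin n, (p : ℕ) + 1 = i k → (q : ℕ) = i k → Wn n i J k p < Wn n i J k q)
    (k : ℕ) (hk : k ≤ m) :
    (∀ c d, Wn n i J k d < c → Gn n i J t k c d = 0) ∧
    (∀ d, Gn n i J t k (Wn n i J k d) d = eps (Wn n i J k) d) := by
  induction k with
  | zero =>
    refine ⟨fun c d h => ?_, fun d => ?_⟩
    · simp only [Wn, Equiv.Perm.one_apply] at h
      simp [Gn, Matrix.one_apply_ne h.ne']
    · change (1 : Mat n) d d = eps 1 d
      simp only [Matrix.one_apply_eq, eps]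
      symm; apply Finset.prod_eq_one; intro b hb; rw [if_pos (by simpa using hb)]
  | succ k ih =>
    obtain ⟨ih1, ih2⟩ := ih (by omega)
    obtain ⟨hi1, hi2⟩ := hi k (by omega)
    obtain ⟨p, hp⟩ : ∃ p : Fin n, (p : ℕ) + 1 = i k := ⟨⟨i k - 1, by omega⟩, by simp; omega⟩
    obtain ⟨q, hq⟩ : ∃ q : Fin n, (q : ℕ) = i k := ⟨⟨i k, by omega⟩, by simp⟩
    have hlt := hW k (by omega) p q hp hq
    have hpq : (p : ℕ) + 1 = q := by omega
    have hne : p ≠ q := by intro h; rw [h] at hpq; omega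
    simp only [Wn, Gn]
    generalize Wn n i J k = V at *
    generalize Gn n i J t k = G at *
    by_cases hJ : J k
    · simp only [hJ, if_true, mul_one]
      refine ⟨fun c d h => ?_, fun d => ?_⟩
      · rw [mul_xmat hp hq]
        split_ifs with hd
        · subst hd; rw [ih1 _ _ h, ih1 _ _ (hlt.trans h)]; simp
        · exact ih1 _ _ h
      · rw [mul_xmat hp hq]
        split_ifs with hd
        · subst hd; rw [ih2, ih1 _ _ hlt]; simp
        · exact ih2 _
    · simp only [hJ, if_false, sperm_eq hp hq]
      refine ⟨fun c d h => ?_, fun d => ?_⟩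
      · rw [mul_sdot hp hq]
        split_ifs with hd hd'
        · subst hd; rw [ih1 _ _ (by simpa using h)]; simp
        · subst hd'; rw [ih1 _ _ (by simpa using h)]
        · exact ih1 _ _ (by simpa [Equiv.swap_apply_of_ne_of_ne hd hd'] using h)
      · rw [mul_sdot hp hq]
        split_ifs with hd hd'
        · subst hd; rw [eps_swap_p hpq _ hlt]; simp [ih2]
        · subst hd'; rw [eps_swap_q hpq _ hlt]; simp [ih2]
        · rw [eps_swap_ne hpq _ _ hd hd']; simp [Equiv.swap_apply_of_ne_of_ne hd hd', ih2]

lemma Gn_off {n m : ℕ} (i : ℕ → ℕ) (t : ℕ → ℂ)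
    (hi : ∀ k < m, 1 ≤ i k ∧ i k < n)
    (k : ℕ) (hk : k ≤ m) (c d : Fin n) (h : c ≠ Wn n i (fun _ => False) k d) :
    Gn n i (fun _ => False) t k c d = 0 := by
  induction k generalizing d with
  | zero =>
    simp only [Wn, Equiv.Perm.one_apply] at h
    simp [Gn, Matrix.one_apply_ne h]
  | succ k ih =>
    obtain ⟨hi1, hi2⟩ := hi k (by omega)
    obtain ⟨p, hp⟩ : ∃ p : Fin n, (p : ℕ) + 1 = i k := ⟨⟨i k - 1, by omega⟩, by simp; omega⟩
    obtain ⟨q, hq⟩ : ∃ q : Fin n, (q : ℕ) = i k := ⟨⟨i k, by omega⟩, by simp⟩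
    simp only [Wn, Gn, if_false, sperm_eq hp hq] at h ⊢
    rw [mul_sdot hp hq]
    split_ifs with hd hd'
    · subst hd; rw [ih (by omega) _ (by simpa using h)]; simp
    · subst hd'; rw [ih (by omega) _ (by simpa using h)]
    · exact ih (by omega) _ (by simpa [Equiv.swap_apply_of_ne_of_ne hd hd'] using h)

def Zn (n : ℕ) (i : ℕ → ℕ) (J : ℕ → Prop) (t : ℕ → ℂ) (z : Mat n) : ℕ → Mat n
  | 0 => z
  | k + 1 => (if J k then xmat (i k) (- t k) else (sdot (i k))ᵀ) * Zn n i J t z k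

lemma Gn_mul_Zn {n m : ℕ} (i : ℕ → ℕ) (J : ℕ → Prop) (t : ℕ → ℂ) (z : Mat n)
    (hi : ∀ k < m, 1 ≤ i k ∧ i k < n) (k : ℕ) (hk : k ≤ m) :
    Gn n i J t k * Zn n i J t z k = z := by
  induction k with
  | zero => simp [Gn, Zn]
  | succ k ih =>
    obtain ⟨hi1, hi2⟩ := hi k (by omega)
    rw [Gn, Zn]
    have : (if J k then xmat (i k) (t k) else sdot (i k) : Mat n) *
        (if J k then xmat (i k) (- t k) else (sdot (i k))ᵀ) = 1 := by
      split_ifs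
      · exact xmat_mul_neg hi1 hi2 _
      · exact sdot_mul_T hi1 hi2
    rw [mul_assoc, ← mul_assoc _ _ (Zn n i J t z k), this, one_mul, ih (by omega)]

def Qp (n : ℕ) (W : Equiv.Perm (Fin n)) (Z : Mat n) : Prop :=
  ∃ γ : Mat n, (∀ a b, a < b → γ a b = 0) ∧ (∀ a, γ a a ≠ 0) ∧
    ∀ a b, b < W a → (γ * Z) a b = 0

lemma Qp_step {n i : ℕ} {p q : Fin n} (hp : (p : ℕ) + 1 = i) (hq : (q : ℕ) = i)
    (W : Equiv.Perm (Fin n)) (hW : W p < W q) (Z ginv : Mat n) (t : ℂ)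
    (hg : (t ≠ 0 ∧ ginv = xmat i (-t)) ∨ ginv = (sdot i)ᵀ)
    (h : Qp n (W * Equiv.swap p q) (ginv * Z)) : Qp n W Z := by
  obtain ⟨γ, h1, h2, h3⟩ := h
  have hpq : (p : ℕ) + 1 = q := by omega
  have hne : p ≠ q := by intro h; rw [h] at hpq; omega
  have hlt : p < q := by rw [Fin.lt_def]; omega
  have gen : ∀ c : ℂ, ∀ a b, b < W a →
      ((xmat i c * (sdot i * (γ * ginv))) * Z : Mat n) a b = 0 := by
    intro c a b hab
    have e : (xmat i c * (sdot i * (γ * ginv))) * Z =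
        xmat i c * (sdot i * (γ * (ginv * Z))) := by simp only [mul_assoc]
    rw [e, xmat_mul hp hq]
    have hs : ∀ a b, b < W a → (sdot i * (γ * (ginv * Z)) : Mat n) a b = 0 := by
      intro a b hab
      rw [sdot_mul hp hq]
      split_ifs with ha ha'
      · subst ha; exact h3 _ _ (by simpa using hab)
      · subst ha'; rw [h3 _ _ (by simpa using hab)]; simp
      · exact h3 _ _ (by simpa [Equiv.swap_apply_of_ne_of_ne ha ha'] using hab)
    split_ifs with ha
    · subst ha; rw [hs _ _ hab, hs _ _ (hab.trans hW)]; simp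
    · exact hs _ _ hab
  rcases hg with ⟨ht, rfl⟩ | rfl
  · refine ⟨xmat i (-(γ q q - t * γ q p) / (t * γ p p)) * (sdot i * (γ * xmat i (-t))), ?_, ?_,
      gen _⟩
    · intro a b hab
      simp only [xmat_mul hp hq, sdot_mul hp hq, mul_xmat hp hq, hne, hne.symm, if_true, if_false]
      have := h2 p
      by_cases ha : a = p
      · subst ha
        by_cases hb : b = q
        · subst hb; simp [h1 _ _ hlt]; field_simp; ring
        · have hb' : q < b := by
            rw [Fin.lt_def] at *; rw [Fin.ext_iff] at hb; omega
          simp [hb, h1 _ _ hb', h1 _ _ hab]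
      · simp only [ha, if_false]
        by_cases ha' : a = q
        · subst ha'
          simp [hab.ne', h1 _ _ (hlt.trans hab)]
        · simp only [ha', if_false]
          split_ifs with hb
          · subst hb
            have : a < p := by
              rw [Fin.lt_def] at *; rw [Fin.ext_iff] at ha ha'; omega
            simp [h1 _ _ hab, h1 _ _ this]
          · exact h1 _ _ hab
    · intro a
      simp only [xmat_mul hp hq, sdot_mul hp hq, mul_xmat hp hq, hne, hne.symm, if_true, if_false]
      have hpp := h2 p
      have hqq := h2 q
      by_cases ha : a = p
      · subst ha
        have : γ q a + -(γ q q - t * γ q a) / (t * γ a a) * -γ a a = γ q q / t := by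
          field_simp; ring
        simp only [if_true, hne, if_false, this]
        exact div_ne_zero hqq ht
      · simp only [ha, if_false]
        by_cases ha' : a = q
        · subst ha'; simp [h1 _ _ hlt, ht, hpp]
        · simp only [ha', if_false]; exact h2 a
  · refine ⟨xmat i (γ q p / γ p p) * (sdot i * (γ * (sdot i)ᵀ)), ?_, ?_,
      gen _⟩
    · intro a b hab
      simp only [xmat_mul hp hq, sdot_mul hp hq, mul_sdotT hp hq, hne, hne.symm, if_true, if_false]
      have := h2 p
      by_cases ha : a = p
      · subst ha
        by_cases hb : b = q
        · subst hb; simp [hne.symm]; field_simp; ring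
        · have hb' : q < b := by
            rw [Fin.lt_def] at *; rw [Fin.ext_iff] at hb; omega
          simp [hb, hab.ne', h1 _ _ hb', h1 _ _ hab]
      · simp only [ha, if_false]
        by_cases ha' : a = q
        · subst ha'
          simp [hab.ne', (hlt.trans hab).ne', h1 _ _ (hlt.trans hab)]
        · simp only [ha', if_false]
          split_ifs with hb hb
          · subst hb
            exact h1 _ _ (hab.trans hlt)
          · subst hb
            have : a < p := by
              rw [Fin.lt_def] at *; rw [Fin.ext_iff] at ha ha'; omega
            simp [h1 _ _ this]
          · exact h1 _ _ hab
    · intro a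
      simp only [xmat_mul hp hq, sdot_mul hp hq, mul_sdotT hp hq, hne, hne.symm, if_true, if_false]
      have hpp := h2 p
      have hqq := h2 q
      by_cases ha : a = p
      · subst ha
        simp [h1 _ _ hlt, hqq]
      · simp only [ha, if_false]
        by_cases ha' : a = q
        · subst ha'; simp [hpp]
        · simp only [ha', if_false]; exact h2 a

lemma Qp_all {n m : ℕ} (i : ℕ → ℕ) (J : ℕ → Prop) (t : ℕ → ℂ) (z : Mat n)
    (hi : ∀ k < m, 1 ≤ i k ∧ i k < n) (ht : ∀ k < m, J k → t k ≠ 0)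
    (hW : ∀ k < m, ∀ p q : Fin n, (p : ℕ) + 1 = i k → (q : ℕ) = i k →
      Wn n i (fun _ => False) k p < Wn n i (fun _ => False) k q)
    (h : Qp n (Wn n i (fun _ => False) m) (Zn n i J t z m)) (k : ℕ) (hk : k ≤ m) :
    Qp n (Wn n i (fun _ => False) k) (Zn n i J t z k) := by
  refine Nat.decreasingInduction' (P := fun k => Qp n (Wn n i (fun _ => False) k) (Zn n i J t z k))
    ?_ hk h
  intro k hk _ h
  obtain ⟨hi1, hi2⟩ := hi k hk
  obtain ⟨p, hp⟩ : ∃ p : Fin n, (p : ℕ) + 1 = i k := ⟨⟨i k - 1, by omega⟩, by simp; omega⟩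
  obtain ⟨q, hq⟩ : ∃ q : Fin n, (q : ℕ) = i k := ⟨⟨i k, by omega⟩, by simp⟩
  simp only [Wn, Zn, if_false, sperm_eq hp hq] at h
  refine Qp_step hp hq _ (hW k hk p q hp hq) _ _ (t k) ?_ h
  by_cases hJ : J k
  · left; exact ⟨ht k hk hJ, by simp [hJ]⟩
  · right; simp [hJ]

def Tdiag (n : ℕ) (i : ℕ → ℕ) (J : ℕ → Prop) (t : ℕ → ℂ) (k : ℕ) (c : Fin n) : ℂ :=
  ∏ r ∈ Finset.range k, if J r then
    t r ^ ((if ∃ x : Fin n, (x : ℕ) + 1 = i r ∧ Wn n i (fun _ => False) (r + 1) x = c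
        then (1 : ℤ) else 0) -
      (if ∃ x : Fin n, (x : ℕ) = i r ∧ Wn n i (fun _ => False) (r + 1) x = c
        then (1 : ℤ) else 0)) else 1

lemma Bn_struct {n m : ℕ} (i : ℕ → ℕ) (J : ℕ → Prop) (t : ℕ → ℂ) (z : Mat n)
    (hi : ∀ k < m, 1 ≤ i k ∧ i k < n) (ht : ∀ k < m, J k → t k ≠ 0)
    (hW : ∀ k < m, ∀ p q : Fin n, (p : ℕ) + 1 = i k → (q : ℕ) = i k →
      Wn n i (fun _ => False) k p < Wn n i (fun _ => False) k q)
    (hz1 : ∀ a b, a < b → z a b = 0) (hz2 : ∀ a, z a a = 1)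
    (h : Qp n (Wn n i (fun _ => False) m) (Zn n i J t z m)) (k : ℕ) (hk : k ≤ m) :
    (∀ a b, a < b → (Zn n i J t z k * Gn n i (fun _ => False) t k) a b = 0) ∧
    ∀ a, (Zn n i J t z k * Gn n i (fun _ => False) t k) a a =
      Tdiag n i J t k (Wn n i (fun _ => False) k a) := by
  induction k with
  | zero =>
    simp only [Zn, Gn, mul_one, Tdiag, Finset.range_zero, Finset.prod_empty]
    exact ⟨hz1, hz2⟩
  | succ k ih =>
    obtain ⟨ih1, ih2⟩ := ih (by omega)
    obtain ⟨hi1, hi2⟩ := hi k (by omega)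
    obtain ⟨p, hp⟩ : ∃ p : Fin n, (p : ℕ) + 1 = i k := ⟨⟨i k - 1, by omega⟩, by simp; omega⟩
    obtain ⟨q, hq⟩ : ∃ q : Fin n, (q : ℕ) = i k := ⟨⟨i k, by omega⟩, by simp⟩
    have hlt := hW k (by omega) p q hp hq
    have hpq : (p : ℕ) + 1 = q := by omega
    have hne : p ≠ q := by intro h; rw [h] at hpq; omega
    have hpq' : p < q := by rw [Fin.lt_def]; omega
    obtain ⟨γ, g1, g2, g3⟩ := Qp_all i J t z hi ht hW h (k + 1) hk
    have hWs : Wn n i (fun _ => False) (k + 1) = Wn n i (fun _ => False) k * Equiv.swap p q := by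
      simp [Wn, sperm_eq hp hq]
    -- the new matrix
    have eB : Zn n i J t z (k + 1) * Gn n i (fun _ => False) t (k + 1) =
        (if J k then xmat (i k) (- t k) else (sdot (i k))ᵀ) *
          ((Zn n i J t z k * Gn n i (fun _ => False) t k) * sdot (i k)) := by
      simp only [Zn, Gn, if_false, mul_assoc]
    have hDpq : (∀ a < p, (Zn n i J t z (k + 1) * Gn n i (fun _ => False) t (k + 1)) a q = 0) →
        (Zn n i J t z (k + 1) * Gn n i (fun _ => False) t (k + 1)) p q = 0 := by
      intro h0
      have e1 : (γ * (Zn n i J t z (k + 1) * Gn n i (fun _ => False) t (k + 1))) p q =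
          γ p p * (Zn n i J t z (k + 1) * Gn n i (fun _ => False) t (k + 1)) p q := by
        rw [Matrix.mul_apply]
        apply Finset.sum_eq_single p
        · intro c _ hc
          rcases lt_or_gt_of_ne hc with hc | hc
          · rw [h0 c hc, mul_zero]
          · rw [g1 _ _ hc, zero_mul]
        · simp
      have e2 : (γ * (Zn n i J t z (k + 1) * Gn n i (fun _ => False) t (k + 1))) p q = 0 := by
        rw [← mul_assoc, Matrix.mul_apply]
        apply Finset.sum_eq_zero
        intro c _
        by_cases hc : c = Wn n i (fun _ => False) (k + 1) q
        · rw [g3 p c, zero_mul]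
          rw [hc, hWs]; simpa using hlt
        · rw [Gn_off i t hi (k + 1) hk _ _ hc, mul_zero]
      rw [e1] at e2
      exact (mul_eq_zero.mp e2).resolve_left (g2 p)
    have hT : ∀ a, Tdiag n i J t (k + 1) (Wn n i (fun _ => False) (k + 1) a) =
        Tdiag n i J t k (Wn n i (fun _ => False) k (Equiv.swap p q a)) *
        if J k then t k ^ ((if p = a then (1 : ℤ) else 0) - (if q = a then (1 : ℤ) else 0))
          else 1 := by
      intro a
      rw [Tdiag, Finset.prod_range_succ]
      congr 1
      · have : Wn n i (fun _ => False) (k + 1) a =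
            Wn n i (fun _ => False) k (Equiv.swap p q a) := by rw [hWs]; rfl
        rw [this]; rfl
      · have x1 : (∃ x : Fin n, (x : ℕ) + 1 = i k ∧ Wn n i (fun _ => False) (k + 1) x =
            Wn n i (fun _ => False) (k + 1) a) ↔ p = a := by
          constructor
          · rintro ⟨x, hx, hx'⟩
            rw [← (Wn n i (fun _ => False) (k + 1)).injective hx']
            ext; omega
          · rintro rfl; exact ⟨p, hp, rfl⟩
        have x2 : (∃ x : Fin n, (x : ℕ) = i k ∧ Wn n i (fun _ => False) (k + 1) x =
            Wn n i (fun _ => False) (k + 1) a) ↔ q = a := by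
          constructor
          · rintro ⟨x, hx, hx'⟩
            rw [← (Wn n i (fun _ => False) (k + 1)).injective hx']
            ext; omega
          · rintro rfl; exact ⟨q, hq, rfl⟩
        simp only [x1, x2]
    simp only [hT]
    rw [eB] at hDpq ⊢
    have ih2p := ih2 p
    have ih2q := ih2 q
    generalize Zn n i J t z k * Gn n i (fun _ => False) t k = B at *
    by_cases hJ : J k
    · have htk := ht k (by omega) hJ
      simp only [hJ, if_true] at hDpq ⊢
      have hD0 : B p p - t k * B q p = 0 := by
        have := hDpq (by
          intro a ha
          have haq : a ≠ q := (ha.trans hpq').ne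
          simp only [xmat_mul hp hq, mul_sdot hp hq, hne, hne.symm, if_true, if_false, ha.ne]
          exact ih1 _ _ ha)
        simp only [xmat_mul hp hq, mul_sdot hp hq, hne, hne.symm, if_true, if_false] at this
        rw [← this]; ring
      constructor
      · intro a b hab
        simp only [xmat_mul hp hq, mul_sdot hp hq]
        by_cases ha : a = p
        · subst ha
          simp only [if_true, hab.ne', if_false]
          split_ifs with hb
          · rw [← hD0]; ring
          · have hb' : q < b := by
              rw [Fin.lt_def] at *; rw [Fin.ext_iff] at hb; omega
            simp [ih1 _ _ hb', ih1 _ _ hab]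
        · simp only [ha, if_false]
          split_ifs with hb hb
          · subst hb; rw [ih1 _ _ (hab.trans hpq'), neg_zero]
          · subst hb
            apply ih1
            rw [Fin.lt_def] at *; rw [Fin.ext_iff] at ha; omega
          · exact ih1 _ _ hab
      · intro a
        simp only [xmat_mul hp hq, mul_sdot hp hq]
        by_cases ha : a = p
        · subst ha
          simp [hne.symm, ih1 _ _ hpq', ih2q]; ring
        · by_cases ha' : a = q
          · subst ha'
            simp only [ha, if_false, if_true, hne, Equiv.swap_apply_right, ← ih2p]
            have : B p p = t k * B a p := by linear_combination hD0
            rw [this]; simp; field_simp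
          · simp [ha, ha', Ne.symm ha, Ne.symm ha', Equiv.swap_apply_of_ne_of_ne ha ha', ih2]
    · simp only [hJ, if_false] at hDpq ⊢
      have hD0 : B q p = 0 := by
        have := hDpq (by
          intro a ha
          have haq : a ≠ q := (ha.trans hpq').ne
          simp only [sdotT_mul hp hq, mul_sdot hp hq, hne, hne.symm, if_true, if_false, ha.ne, haq]
          exact ih1 _ _ ha)
        simpa only [sdotT_mul hp hq, mul_sdot hp hq, hne, hne.symm, if_true, if_false,
          neg_eq_zero] using this
      constructor
      · intro a b hab
        simp only [sdotT_mul hp hq, mul_sdot hp hq]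
        by_cases ha : a = p
        · subst ha
          simp only [if_true, hab.ne', if_false]
          split_ifs with hb
          · rw [hD0, neg_zero]
          · have hb' : q < b := by
              rw [Fin.lt_def] at *; rw [Fin.ext_iff] at hb; omega
            simp [ih1 _ _ hb']
        · simp only [ha, if_false]
          by_cases ha' : a = q
          · subst ha'
            simp [hab.ne', (hpq'.trans hab).ne', ih1 _ _ (hpq'.trans hab)]
          · simp only [ha', if_false]
            split_ifs with hb hb
            · subst hb; rw [ih1 _ _ (hab.trans hpq'), neg_zero]
            · subst hb
              apply ih1
              rw [Fin.lt_def] at *; rw [Fin.ext_iff] at ha; omega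
            · exact ih1 _ _ hab
      · intro a
        simp only [sdotT_mul hp hq, mul_sdot hp hq]
        by_cases ha : a = p
        · subst ha
          simp [ih2q]
        · by_cases ha' : a = q
          · subst ha'
            simp [ha, ih2p]
          · simp [ha, ha', Equiv.swap_apply_of_ne_of_ne ha ha', ih2]

lemma sign_eps {n k : ℕ} (S : Finset (Fin n)) (hS : ∀ a ∈ S, ∀ b, a < b → b ∈ S)
    (eS : Fin k ≃o S) (w : Equiv.Perm (Fin n)) (ψ : Equiv.Perm (Fin k))
    (h : ∀ a b, ψ a < ψ b ↔ w (eS a) < w (eS b)) :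
    ((Equiv.Perm.sign ψ : ℤ) : ℂ) = ∏ x : S, eps w x := by
  rw [Equiv.Perm.sign_eq_prod_prod_Ioi]
  push_cast
  apply Finset.prod_equiv eS.toEquiv
  · simp
  · intro a _
    rw [eps]
    have : Finset.Ioi ((eS.toEquiv a : S) : Fin n) =
        (Finset.Ioi a).map (eS.toEquiv.toEmbedding.trans (Function.Embedding.subtype _)) := by
      ext x
      simp only [Finset.mem_Ioi, Finset.mem_map]
      constructor
      · intro hx
        have hxS := hS _ (eS.toEquiv a).2 _ hx
        refine ⟨eS.symm ⟨x, hxS⟩, ?_, by simp⟩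
        rw [OrderIso.lt_symm_apply]
        exact hx
      · rintro ⟨b, hb, rfl⟩
        exact (eS.lt_iff_lt.mpr hb)
    rw [this, Finset.prod_map]
    apply Finset.prod_congr rfl
    intro b _
    simp only [h]
    by_cases hc : w (eS a) < w (eS b)
    · rw [if_pos hc]; simp [hc]
    · rw [if_neg hc]; simp [hc]

lemma sign_aux {n k : ℕ} (S : Finset (Fin n)) (hS : ∀ a ∈ S, ∀ b, a < b → b ∈ S)
    (hk : S.card = k) (w : Equiv.Perm (Fin n)) (hR : (S.image w).card = k) :
    ∃ ρ : Equiv.Perm (Fin k), ((Equiv.Perm.sign ρ : ℤ) : ℂ) = ∏ x : S, eps w x ∧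
      ∀ a, (S.image w).orderEmbOfFin hR a = w (S.orderIsoOfFin hk (ρ a)) := by
  have hmem : ∀ a, w⁻¹ ((S.image w).orderEmbOfFin hR a) ∈ S := by
    intro a
    have := Finset.orderEmbOfFin_mem (S.image w) hR a
    obtain ⟨x, hx, hx'⟩ := Finset.mem_image.mp this
    rw [← hx']; simpa using hx
  let f : Fin k → Fin k := fun a => (S.orderIsoOfFin hk).symm ⟨_, hmem a⟩
  have hf : ∀ a, w (S.orderIsoOfFin hk (f a)) = (S.image w).orderEmbOfFin hR a := by
    intro a; simp [f]
  have finj : Function.Injective f := by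
    intro a b hab
    apply ((S.image w).orderEmbOfFin hR).injective
    rw [← hf, ← hf, hab]
  let ρ : Equiv.Perm (Fin k) := Equiv.ofBijective f (Finite.injective_iff_bijective.mp finj)
  refine ⟨ρ, ?_, fun a => (hf a).symm⟩
  rw [← sign_eps S hS (S.orderIsoOfFin hk) w ρ⁻¹, Equiv.Perm.sign_inv]
  intro a b
  have h1 : ∀ a, w (S.orderIsoOfFin hk a) = (S.image w).orderEmbOfFin hR (ρ⁻¹ a) := by
    intro a
    rw [← hf]
    have : f (ρ⁻¹ a) = a := ρ.apply_symm_apply a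
    rw [this]
  rw [h1, h1]; simp

lemma minor_eq {n : ℕ} (S : Finset (Fin n)) (hS : ∀ a ∈ S, ∀ b, a < b → b ∈ S)
    (w v : Equiv.Perm (Fin n)) (f : Mat n) :
    minor f (S.image w) (S.image v) = (∏ x : S, eps w x) * (∏ x : S, eps v x) *
      (Matrix.of fun a b : S => f (w a) (v b)).det := by
  have hw : (S.image w).card = S.card := Finset.card_image_of_injective _ w.injective
  have hv : (S.image v).card = S.card := Finset.card_image_of_injective _ v.injective
  have h : (S.image w).card = (S.image v).card := by rw [hw, hv]
  rw [minor, dif_pos h]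
  obtain ⟨ρ, hρ, hρ'⟩ := sign_aux S hS hw.symm w rfl
  obtain ⟨σ, hσ, hσ'⟩ := sign_aux S hS hw.symm v h.symm
  simp only [hρ', hσ']
  rw [← hρ, ← hσ]
  have e : (Matrix.of fun a b : Fin (S.image w).card =>
      f (w (S.orderIsoOfFin hw.symm (ρ a))) (v (S.orderIsoOfFin hw.symm (σ b)))) =
      ((((Matrix.of fun a b : S => f (w a) (v b)).submatrix (S.orderIsoOfFin hw.symm).toEquiv
        (S.orderIsoOfFin hw.symm).toEquiv).submatrix id σ).submatrix ρ id) := by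
    ext a b; simp
  rw [e, Matrix.det_permute, Matrix.det_permute', Matrix.det_submatrix_equiv_self]
  ring

lemma det_upper_lift {n : ℕ} {ι : Type*} [Fintype ι] [DecidableEq ι] (M : Matrix ι ι ℂ)
    (φ : ι → Fin n) (hφ : Function.Injective φ) (h : ∀ a b, φ b < φ a → M a b = 0) :
    M.det = ∏ a, M a a := by
  let _ : LinearOrder ι := LinearOrder.lift' φ hφ
  apply Matrix.det_of_isUpperTriangular
  intro a b hab
  exact h a b hab

lemma det_lower_lift {n : ℕ} {ι : Type*} [Fintype ι] [DecidableEq ι] (M : Matrix ι ι ℂ)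
    (φ : ι → Fin n) (hφ : Function.Injective φ) (h : ∀ a b, φ a < φ b → M a b = 0) :
    M.det = ∏ a, M a a := by
  rw [← Matrix.det_transpose, det_upper_lift Mᵀ φ hφ (fun a b hab => h b a hab)]
  rfl

/-- The abstract minor evaluation. -/
lemma minor_eval {n m : ℕ} (i : ℕ → ℕ) (J : ℕ → Prop) (t : ℕ → ℂ) (z : Mat n)
    (hi : ∀ k < m, 1 ≤ i k ∧ i k < n) (ht : ∀ k < m, J k → t k ≠ 0)
    (hW : ∀ k < m, ∀ p q : Fin n, (p : ℕ) + 1 = i k → (q : ℕ) = i k →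
      Wn n i (fun _ => False) k p < Wn n i (fun _ => False) k q)
    (hV : ∀ k < m, ∀ p q : Fin n, (p : ℕ) + 1 = i k → (q : ℕ) = i k →
      Wn n i J k p < Wn n i J k q)
    (hz1 : ∀ a b, a < b → z a b = 0) (hz2 : ∀ a, z a a = 1)
    (h : Qp n (Wn n i (fun _ => False) m) (Zn n i J t z m)) (k : ℕ) (hk : k ≤ m)
    (S : Finset (Fin n)) (hS : ∀ a ∈ S, ∀ b, a < b → b ∈ S) :
    minor zᵀ (S.image (Wn n i (fun _ => False) k)) (S.image (Wn n i J k)) =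
      ∏ x ∈ S, Tdiag n i J t k (Wn n i (fun _ => False) k x) := by
  obtain ⟨B1, B2⟩ := Bn_struct i J t z hi ht hW hz1 hz2 h k hk
  obtain ⟨G1, G2⟩ := Gn_struct i J t hi hV k hk
  obtain ⟨_, W2⟩ := Gn_struct i (fun _ => False) t hi hW k hk
  have W1 := Gn_off i t hi k hk
  have hGZ : z * Gn n i (fun _ => False) t k =
      Gn n i J t k * (Zn n i J t z k * Gn n i (fun _ => False) t k) := by
    rw [← mul_assoc, Gn_mul_Zn i J t z hi k hk]
  rw [minor_eq S hS, ← Matrix.det_transpose]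
  generalize Zn n i J t z k * Gn n i (fun _ => False) t k = B at *
  generalize Gn n i (fun _ => False) t k = Wd at *
  generalize Gn n i J t k = G at *
  generalize Wn n i (fun _ => False) k = W at *
  generalize Wn n i J k = V at *
  have hmat : (Matrix.of fun a b : S => zᵀ (W a) (V b))ᵀ * Matrix.diagonal (fun a : S => eps W a) =
      (Matrix.of fun a b : S => G (V a) b) * (Matrix.of fun a b : S => B a b) := by
    ext a b
    rw [Matrix.mul_diagonal, Matrix.mul_apply]
    simp only [Matrix.transpose_apply, Matrix.of_apply]
    have e := congrFun (congrFun hGZ (V a)) b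
    rw [Matrix.mul_apply, Matrix.mul_apply, Finset.sum_eq_single (W b)] at e
    · rw [W2] at e
      rw [e]
      rw [Finset.sum_coe_sort S (fun x => G (V a) x * B x b)]
      symm
      apply Finset.sum_subset (Finset.subset_univ _)
      intro x _ hx
      rw [B1, mul_zero]
      by_contra hlt
      rcases lt_or_eq_of_le (not_lt.mp hlt) with h' | h'
      · exact hx (hS _ b.2 _ h')
      · exact hx (h' ▸ b.2)
    · intro c _ hc
      rw [W1 _ _ hc, mul_zero]
    · simp
  have hd := congrArg Matrix.det hmat
  rw [Matrix.det_mul, Matrix.det_mul, Matrix.det_diagonal,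
    det_upper_lift (Matrix.of fun a b : S => G (V a) b) (fun a => V a)
      (fun a b hab => Subtype.ext (V.injective hab)) (fun a b hab => G1 _ _ hab),
    det_lower_lift (Matrix.of fun a b : S => B a b) (fun a => (a : Fin n))
      Subtype.val_injective (fun a b hab => B1 _ _ hab)] at hd
  simp only [Matrix.of_apply, G2, B2] at hd
  have sqV : (∏ x : S, eps V x) * ∏ x : S, eps V x = 1 := by
    rw [← Finset.prod_mul_distrib]; simp [eps_sq]
  rw [← Finset.prod_coe_sort S]
  linear_combination (∏ x : S, eps V x) * hd +
    (∏ x : S, Tdiag n i J t k (W x)) * sqV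

lemma take_ofFn_prod {M : Type*} [Monoid M] {m : ℕ} (f : Fin m → M) (F : ℕ → M) (h0 : F 0 = 1)
    (hs : ∀ k (h : k < m), F (k + 1) = F k * f ⟨k, h⟩) (k : ℕ) (hk : k ≤ m) :
    ((List.ofFn f).take k).prod = F k := by
  induction k with
  | zero => simp [h0]
  | succ k ih =>
    rw [List.prod_take_succ _ _ (by simpa using hk), ih (by omega), hs k (by omega)]
    simp

lemma lower_inv {n : ℕ} (b : Mat n) (hb : ∀ a c, a < c → b a c = 0) (hd : b.det ≠ 0) :
    (∀ a c, a < c → b⁻¹ a c = 0) ∧ ∀ a, b⁻¹ a a ≠ 0 := by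
  have hu : IsUnit b.det := isUnit_iff_ne_zero.mpr hd
  have : Invertible b := Matrix.invertibleOfIsUnitDet b hu
  have h1 : ∀ a c, a < c → b⁻¹ a c = 0 := by
    have hbt : b.BlockTriangular OrderDual.toDual := fun a c hac => hb a c hac
    have := Matrix.blockTriangular_inv_of_blockTriangular hbt
    intro a c hac
    exact this hac
  refine ⟨h1, ?_⟩
  have hdet := det_lower_lift b⁻¹ id Function.injective_id h1
  have : b⁻¹.det ≠ 0 := by
    intro h0
    have := congrArg Matrix.det (Matrix.nonsing_inv_mul b hu)
    rw [Matrix.det_mul, h0] at this; simp at this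
  rw [hdet, Finset.prod_ne_zero_iff] at this
  intro a; exact this a (Finset.mem_univ _)

lemma upper_inv {n : ℕ} (b : Mat n) (hb : ∀ a c, c < a → b a c = 0) (hd : b.det ≠ 0) :
    (∀ a c, c < a → b⁻¹ a c = 0) := by
  have := (lower_inv bᵀ (fun a c h => hb c a h) (by simpa using hd)).1
  intro a c h
  have h' := this c a h
  rwa [← Matrix.transpose_nonsing_inv] at h'

lemma det_sdot {n i : ℕ} (h1 : 1 ≤ i) (h2 : i < n) : (sdot i : Mat n).det = 1 := by
  obtain ⟨p, hp⟩ : ∃ p : Fin n, (p : ℕ) + 1 = i := ⟨⟨i - 1, by omega⟩, by simp; omega⟩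
  obtain ⟨q, hq⟩ : ∃ q : Fin n, (q : ℕ) = i := ⟨⟨i, by omega⟩, by simp⟩
  have hne : p ≠ q := by intro h; rw [h] at hp; omega
  have e : (sdot i : Mat n) = Matrix.diagonal (fun a => if a = q then (-1 : ℂ) else 1) *
      ((1 : Mat n).submatrix (Equiv.swap p q) id) := by
    ext a b
    rw [Matrix.diagonal_mul]
    simp only [sdot, Matrix.submatrix_apply, Matrix.of_apply, Matrix.one_apply, id,
      Equiv.swap_apply_def, Fin.ext_iff]
    grind
  rw [e, Matrix.det_mul, Matrix.det_diagonal, Matrix.det_permute, Equiv.Perm.sign_swap hne]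
  simp

lemma det_Gn {n m : ℕ} (i : ℕ → ℕ) (t : ℕ → ℂ) (hi : ∀ k < m, 1 ≤ i k ∧ i k < n)
    (k : ℕ) (hk : k ≤ m) : (Gn n i (fun _ => False) t k).det = 1 := by
  induction k with
  | zero => simp [Gn]
  | succ k ih =>
    simp only [Gn, if_false]
    rw [Matrix.det_mul, ih (by omega), det_sdot (hi k (by omega)).1 (hi k (by omega)).2, mul_one]

lemma Qp_base {n m : ℕ} (i : ℕ → ℕ) (J : ℕ → Prop) (t : ℕ → ℂ)
    (hi : ∀ k < m, 1 ≤ i k ∧ i k < n) (b U : Mat n)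
    (hb : ∀ a c, a < c → b a c = 0) (hd : b.det ≠ 0) (hU : ∀ a c, c < a → U a c = 0) (z : Mat n)
    (hz : z = Gn n i J t m * b * (Gn n i (fun _ => False) t m)ᵀ * U) :
    Qp n (Wn n i (fun _ => False) m) (Zn n i J t z m) := by
  have hu : IsUnit b.det := isUnit_iff_ne_zero.mpr hd
  obtain ⟨l1, l2⟩ := lower_inv b hb hd
  have hG1 : Zn n i J t 1 m * Gn n i J t m = 1 :=
    mul_eq_one_comm.mp (Gn_mul_Zn i J t 1 hi m le_rfl)
  have hZ : Zn n i J t z m = b * ((Gn n i (fun _ => False) t m)ᵀ * U) := by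
    have := Gn_mul_Zn i J t z hi m le_rfl
    calc Zn n i J t z m = (Zn n i J t 1 m * Gn n i J t m) * Zn n i J t z m := by rw [hG1, one_mul]
      _ = Zn n i J t 1 m * (Gn n i J t m * Zn n i J t z m) := by rw [mul_assoc]
      _ = Zn n i J t 1 m * (Gn n i J t m * b * (Gn n i (fun _ => False) t m)ᵀ * U) := by
          rw [this, ← hz]
      _ = (Zn n i J t 1 m * Gn n i J t m) * (b * ((Gn n i (fun _ => False) t m)ᵀ * U)) := by
          simp only [mul_assoc]
      _ = _ := by rw [hG1, one_mul]
  refine ⟨b⁻¹, l1, l2, ?_⟩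
  intro a c hac
  rw [hZ, ← mul_assoc, Matrix.nonsing_inv_mul b hu, one_mul, Matrix.mul_apply]
  apply Finset.sum_eq_zero
  intro x _
  by_cases hx : x = Wn n i (fun _ => False) m a
  · rw [hU x c (hx ▸ hac), mul_zero]
  · rw [Matrix.transpose_apply, Gn_off i t hi m le_rfl x a hx, zero_mul]

lemma LDU_exists {n : ℕ} (X γ P : Mat n) (hX : X.det = 1) (g1 : ∀ a b, a < b → γ a b = 0)
    (g2 : ∀ a, γ a a ≠ 0) (hP : ∀ a b, b < a → P a b = 0) (h : γ * Xᵀ = P) :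
    ∃ d e f, LDU X d e f := by
  have hγ : γ.det ≠ 0 := by
    rw [det_lower_lift γ id Function.injective_id g1, Finset.prod_ne_zero_iff]
    intro a _; exact g2 a
  obtain ⟨l1, l2⟩ := lower_inv γ g1 hγ
  have hPd : P.det ≠ 0 := by rw [← h, Matrix.det_mul, Matrix.det_transpose, hX, mul_one]; exact hγ
  have hPa : ∀ a, P a a ≠ 0 := by
    rw [det_upper_lift P id Function.injective_id hP, Finset.prod_ne_zero_iff] at hPd
    intro a; exact hPd a (Finset.mem_univ _)
  have hXe : X = Pᵀ * (γ⁻¹)ᵀ := by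
    rw [← Matrix.transpose_mul, ← h, ← mul_assoc,
      Matrix.nonsing_inv_mul γ (isUnit_iff_ne_zero.mpr hγ), one_mul, Matrix.transpose_transpose]
  generalize γ⁻¹ = δ at *
  have hdN : IsNm (Pᵀ * Matrix.diagonal (fun a => (P a a)⁻¹)) := by
    refine ⟨fun a => ?_, fun a b hab => ?_⟩
    · rw [Matrix.mul_diagonal, Matrix.transpose_apply, mul_inv_cancel₀ (hPa a)]
    · rw [Matrix.mul_diagonal, Matrix.transpose_apply, hP _ _ hab, zero_mul]
  have hfN : IsN (Matrix.diagonal (fun a => (δ a a)⁻¹) * δᵀ) := by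
    refine ⟨fun a => ?_, fun a b hab => ?_⟩
    · rw [Matrix.diagonal_mul, Matrix.transpose_apply, inv_mul_cancel₀ (l2 a)]
    · rw [Matrix.diagonal_mul, Matrix.transpose_apply, l1 _ _ hab, mul_zero]
  have hmul : X = (Pᵀ * Matrix.diagonal (fun a => (P a a)⁻¹)) *
      Matrix.diagonal (fun a => P a a * δ a a) * (Matrix.diagonal (fun a => (δ a a)⁻¹) * δᵀ) := by
    rw [hXe]
    have : Matrix.diagonal (fun a => (P a a)⁻¹) * Matrix.diagonal (fun a => P a a * δ a a) *
        Matrix.diagonal (fun a => (δ a a)⁻¹) = (1 : Mat n) := by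
      rw [Matrix.diagonal_mul_diagonal, Matrix.diagonal_mul_diagonal, ← Matrix.diagonal_one]
      congr 1; ext a
      have := hPa a; have := l2 a
      field_simp
    calc Pᵀ * δᵀ = Pᵀ * (Matrix.diagonal (fun a => (P a a)⁻¹) *
          Matrix.diagonal (fun a => P a a * δ a a) * Matrix.diagonal (fun a => (δ a a)⁻¹)) * δᵀ := by
            rw [this, mul_one]
      _ = _ := by simp only [mul_assoc]
  refine ⟨_, _, _, hdN, ⟨?_, fun a b hab => Matrix.diagonal_apply_ne _ hab⟩, hfN, hmul⟩
  have hdet := congrArg Matrix.det hmul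
  rw [hX, Matrix.det_mul, Matrix.det_mul,
    det_lower_lift _ id Function.injective_id hdN.2,
    det_upper_lift _ id Function.injective_id hfN.2] at hdet
  simp only [hdN.1, hfN.1, Finset.prod_const_one, one_mul, mul_one] at hdet
  exact hdet.symm

section conn
variable {n m : ℕ} (ii : Fin m → ℕ) (v : Equiv.Perm (Fin n)) (t : Fin m → ℂ)

def iN (k : ℕ) : ℕ := if h : k < m then ii ⟨k, h⟩ else 0
def JN (k : ℕ) : Prop := ∃ h : k < m, inJ ii v ⟨k, h⟩
def tN (k : ℕ) : ℂ := if h : k < m then t ⟨k, h⟩ else 0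

lemma iN_eq (r : Fin m) : iN ii r = ii r := by simp [iN]
lemma JN_iff (r : Fin m) : JN ii v r ↔ inJ ii v r := by simp [JN]
lemma tN_eq (r : Fin m) : tN t r = t r := by simp [tN]

lemma take_s (k : ℕ) (hk : k ≤ m) :
    ((sPermList n ii).take k).prod = Wn n (iN ii) (fun _ => False) k := by
  apply take_ofFn_prod _ _ rfl _ k hk
  intro k h
  simp [Wn, iN, h]

lemma take_sv (k : ℕ) (hk : k ≤ m) :
    ((svPermList ii v).take k).prod = Wn n (iN ii) (JN ii v) k := by
  apply take_ofFn_prod _ _ rfl _ k hk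
  intro k h
  simp [Wn, iN, JN, h]

lemma wMR_eq (t' : ℕ → ℂ) : (wMR n ii : Mat n) = Gn n (iN ii) (fun _ => False) t' m := by
  have := take_ofFn_prod (fun r => (sdot (ii r) : Mat n)) (Gn n (iN ii) (fun _ => False) t') rfl
    (by intro k h; simp [Gn, iN, h]) m le_rfl
  rw [List.take_of_length_le (by simp)] at this
  exact this

lemma mrg_eq : mrg ii v t = Gn n (iN ii) (JN ii v) (tN t) m := by
  have := take_ofFn_prod (fun r => if inJ ii v r then xmat (ii r) (t r) else sdot (ii r))
    (Gn n (iN ii) (JN ii v) (tN t)) rfl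
    (by intro k h; simp [Gn, iN, JN, tN, h]) m le_rfl
  rw [List.take_of_length_le (by simp)] at this
  exact this

lemma len_one : len (1 : Equiv.Perm (Fin n)) = 0 := by
  rw [len, Finset.card_eq_zero, Finset.filter_eq_empty_iff]
  rintro ⟨a, b⟩ _ ⟨h1, h2⟩
  exact lt_asymm h1 h2

lemma red_lt (hii : ∀ r, 1 ≤ ii r ∧ ii r < n)
    (hred : len (Wn n (iN ii) (fun _ => False) m) = m) :
    ∀ k < m, ∀ p q : Fin n, (p : ℕ) + 1 = iN ii k → (q : ℕ) = iN ii k →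
      Wn n (iN ii) (fun _ => False) k p < Wn n (iN ii) (fun _ => False) k q := by
  have step : ∀ k < m, len (Wn n (iN ii) (fun _ => False) (k + 1)) ≤
      len (Wn n (iN ii) (fun _ => False) k) + 1 := by
    intro k hk
    have hh := hii ⟨k, hk⟩
    have e := iN_eq ii ⟨k, hk⟩
    simp only at e
    rw [← e] at hh
    obtain ⟨p, hp⟩ : ∃ p : Fin n, (p : ℕ) + 1 = iN ii k := ⟨⟨iN ii k - 1, by omega⟩, by simp; omega⟩
    obtain ⟨q, hq⟩ : ∃ q : Fin n, (q : ℕ) = iN ii k := ⟨⟨iN ii k, by omega⟩, by simp⟩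
    have hpq : (p : ℕ) + 1 = q := by omega
    simp only [Wn, if_false, sperm_eq hp hq]
    by_cases hl : Wn n (iN ii) (fun _ => False) k p < Wn n (iN ii) (fun _ => False) k q
    · rw [len_mul_swap hpq _ hl]
    · have := len_mul_swap' hpq _ (lt_of_not hpq _ hl)
      omega
  have up : ∀ k ≤ m, len (Wn n (iN ii) (fun _ => False) k) ≤ k := by
    intro k hk
    induction k with
    | zero => simp [Wn, len_one]
    | succ k ih => have := step k (by omega); have := ih (by omega); omega
  have down : ∀ d, d ≤ m → m ≤ len (Wn n (iN ii) (fun _ => False) (m - d)) + d := by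
    intro d hd
    induction d with
    | zero => simp [hred]
    | succ d ih =>
      have h1 := ih (by omega)
      have h2 := step (m - (d + 1)) (by omega)
      have : m - (d + 1) + 1 = m - d := by omega
      rw [this] at h2; omega
  intro k hk p q hp hq
  have hpq : (p : ℕ) + 1 = q := by omega
  by_contra hl
  have h1 := len_mul_swap' hpq _ (lt_of_not hpq _ hl)
  have h2 : Wn n (iN ii) (fun _ => False) (k + 1) =
      Wn n (iN ii) (fun _ => False) k * Equiv.swap p q := by simp [Wn, sperm_eq hp hq]
  have h3 := down (m - (k + 1)) (by omega)
  have h4 := up k (by omega)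
  have : m - (m - (k + 1)) = k + 1 := by omega
  rw [this, h2] at h3
  omega

lemma v_step (hii : ∀ r, 1 ≤ ii r ∧ ii r < n) (k : ℕ) (hk : k < m) (p q : Fin n)
    (hp : (p : ℕ) + 1 = iN ii k) (hq : (q : ℕ) = iN ii k) :
    vseq ii v (m - (k + 1)) = vseq ii v (m - k) * (if JN ii v k then 1 else sperm n (iN ii k)) ∧
    vseq ii v (m - k) p < vseq ii v (m - k) q := by
  have hpq : (p : ℕ) + 1 = q := by omega
  have hne : p ≠ q := by intro h; rw [h] at hpq; omega
  have e1 : m - k = (m - (k + 1)) + 1 := by omega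
  have e2 : m - (m - (k + 1)) - 1 = k := by omega
  have hi : ii ⟨k, hk⟩ = iN ii k := (iN_eq ii ⟨k, hk⟩).symm
  have hv : vseq ii v (m - k) = if len (vseq ii v (m - (k + 1)) * Equiv.swap p q) <
      len (vseq ii v (m - (k + 1))) then vseq ii v (m - (k + 1)) * Equiv.swap p q
      else vseq ii v (m - (k + 1)) := by
    rw [e1, vseq, dif_pos (by omega)]
    have : (⟨m - (m - (k + 1)) - 1, by omega⟩ : Fin m) = ⟨k, hk⟩ := by ext; simpa using e2
    rw [this, hi, sperm_eq hp hq]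
  have hJ : JN ii v k ↔ vseq ii v (m - k) = vseq ii v (m - (k + 1)) := by
    simp only [JN, hk, exists_true_left, inJ, Nat.sub_sub]
  rw [sperm_eq hp hq, hJ]
  generalize vseq ii v (m - (k + 1)) = u at *
  generalize vseq ii v (m - k) = u' at *
  by_cases hl : u p < u q
  · have := len_mul_swap hpq u hl
    rw [if_neg (by omega)] at hv
    subst hv
    simp [hl]
  · have hl' := lt_of_not hpq _ hl
    have := len_mul_swap' hpq u hl'
    rw [if_pos (by omega)] at hv
    have hneq : u' ≠ u := by
      rw [hv]; intro h
      have : Equiv.swap p q = 1 := by simpa using h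
      have h2 := congrArg (fun f => f p) this
      simp at h2; exact hne h2.symm
    subst hv
    rw [if_neg hneq]
    simp [mul_assoc, hl']

lemma vseq_eq (hii : ∀ r, 1 ≤ ii r ∧ ii r < n) (hv0 : vseq ii v m = 1) (k : ℕ) (hk : k ≤ m) :
    vseq ii v (m - k) = Wn n (iN ii) (JN ii v) k := by
  induction k with
  | zero => simp [Wn, hv0]
  | succ k ih =>
    have hh := hii ⟨k, by omega⟩
    have e := iN_eq ii ⟨k, by omega⟩
    simp only at e
    rw [← e] at hh
    obtain ⟨p, hp⟩ : ∃ p : Fin n, (p : ℕ) + 1 = iN ii k := ⟨⟨iN ii k - 1, by omega⟩, by simp; omega⟩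
    obtain ⟨q, hq⟩ : ∃ q : Fin n, (q : ℕ) = iN ii k := ⟨⟨iN ii k, by omega⟩, by simp⟩
    rw [(v_step ii v hii k (by omega) p q hp hq).1, ih (by omega), Wn]

lemma v_lt (hii : ∀ r, 1 ≤ ii r ∧ ii r < n) (hv0 : vseq ii v m = 1) :
    ∀ k < m, ∀ p q : Fin n, (p : ℕ) + 1 = iN ii k → (q : ℕ) = iN ii k →
      Wn n (iN ii) (JN ii v) k p < Wn n (iN ii) (JN ii v) k q := by
  intro k hk p q hp hq
  rw [← vseq_eq ii v hii hv0 k hk.le]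
  exact (v_step ii v hii k hk p q hp hq).2

lemma q_eq (hii : ∀ r, 1 ≤ ii r ∧ ii r < n) (r k : ℕ) (hrk : r ≤ k) (hk : k ≤ m) :
    (((sPermList n ii).take k).drop r).reverse.prod =
      (Wn n (iN ii) (fun _ => False) k)⁻¹ * Wn n (iN ii) (fun _ => False) r := by
  have h1 : Wn n (iN ii) (fun _ => False) k =
      Wn n (iN ii) (fun _ => False) r * (((sPermList n ii).take k).drop r).prod := by
    rw [← take_s ii k hk, ← take_s ii r (hrk.trans hk)]
    conv_lhs => rw [← List.take_append_drop r ((sPermList n ii).take k)]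
    rw [List.prod_append, List.take_take, min_eq_left hrk]
  have h2 : (((sPermList n ii).take k).drop r).map (fun x => x⁻¹) =
      ((sPermList n ii).take k).drop r := by
    conv_rhs => rw [← List.map_id (((sPermList n ii).take k).drop r)]
    apply List.map_congr_left
    intro x hx
    have hx' := List.mem_of_mem_take (List.mem_of_mem_drop hx)
    rw [sPermList, List.mem_ofFn] at hx'
    obtain ⟨s, rfl⟩ := hx'
    simp only [sperm, id]
    split_ifs
    · rw [Equiv.swap_inv]
    · simp
  have h3 := List.prod_inv_reverse (((sPermList n ii).take k).drop r)
  rw [h2] at h3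
  rw [← h3, h1]; group

end conn

lemma sum_ind {n i : ℕ} (W W' : Equiv.Perm (Fin n)) (y : Fin n) :
    (∑ x ∈ univ.filter (fun x : Fin n => i ≤ (x : ℕ)), if W' y = W x then (1 : ℤ) else 0) =
      1 - if ((W⁻¹ * W') y : ℕ) < i then (1 : ℤ) else 0 := by
  have : ∀ x, (W' y = W x) ↔ (x = (W⁻¹ * W') y) := by
    intro x
    rw [Equiv.Perm.mul_apply, Equiv.Perm.eq_inv_iff_eq, eq_comm]
  simp only [this]
  rw [Finset.sum_ite_eq']
  simp only [mem_filter, mem_univ, true_and]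
  split_ifs <;> omega

lemma prod_Tdiag {n m : ℕ} (ii : Fin m → ℕ) (v : Equiv.Perm (Fin n)) (t : Fin m → ℂ)
    (hii : ∀ r, 1 ≤ ii r ∧ ii r < n) (ht : ∀ r, inJ ii v r → t r ≠ 0) (j : Fin m) :
    (∏ x ∈ univ.filter (fun x : Fin n => ii j ≤ (x : ℕ)),
      Tdiag n (iN ii) (JN ii v) (tN t) ((j : ℕ) + 1)
        (Wn n (iN ii) (fun _ => False) ((j : ℕ) + 1) x)) =
        ∏ r ∈ univ.filter (fun r : Fin m => inJ ii v r ∧ r ≤ j),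
          t r ^
            (-((if ∃ x : Fin n, (x : ℕ) + 1 = ii r ∧
                   ((((((sPermList n ii).take ((j : ℕ) + 1)).drop ((r : ℕ) + 1)).reverse.prod))
                      x : ℕ) < ii j
                then (1 : ℤ) else 0)
              - (if ∃ x : Fin n, (x : ℕ) = ii r ∧
                   ((((((sPermList n ii).take ((j : ℕ) + 1)).drop ((r : ℕ) + 1)).reverse.prod))
                      x : ℕ) < ii j
                then (1 : ℤ) else 0))) := by
  simp only [Tdiag]
  rw [Finset.prod_comm]
  have hext : ∀ F : ℕ → ℂ, ∏ r ∈ Finset.range ((j : ℕ) + 1), F r =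
      ∏ r : Fin m, if r ≤ j then F r else 1 := by
    intro F
    have hcv : (∏ r : Fin m, if r ≤ j then F r else 1) =
        ∏ r : Fin m, if (r : ℕ) ≤ (j : ℕ) then F r else 1 :=
      Finset.prod_congr rfl (fun r _ => by
        by_cases h : r ≤ j
        · rw [if_pos h, if_pos (show (r : ℕ) ≤ (j : ℕ) from h)]
        · rw [if_neg h, if_neg (show ¬ ((r : ℕ) ≤ (j : ℕ)) from h)])
    rw [hcv, ← Finset.prod_range (fun r => if r ≤ (j : ℕ) then F r else 1), ← Finset.prod_filter]
    apply Finset.prod_congr _ (fun _ _ => rfl)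
    ext r; simp only [Finset.mem_range, Finset.mem_filter]
    have := j.2; omega
  rw [hext, Finset.prod_filter]
  apply Finset.prod_congr rfl
  intro r _
  by_cases hr : r ≤ j
  swap
  · simp [hr]
  by_cases hJ : inJ ii v r
  swap
  · simp [hJ, hr, JN_iff]
  simp only [hr, hJ, JN_iff, if_true, and_self, tN_eq, iN_eq]
  have h0 := ht r hJ
  have hh := hii r
  obtain ⟨p, hp⟩ : ∃ p : Fin n, (p : ℕ) + 1 = ii r := ⟨⟨ii r - 1, by omega⟩, by simp; omega⟩
  obtain ⟨q, hq⟩ : ∃ q : Fin n, (q : ℕ) = ii r := ⟨⟨ii r, by omega⟩, by simp⟩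
  have ep : ∀ P : Fin n → Prop, (∃ x : Fin n, (x : ℕ) + 1 = ii r ∧ P x) ↔ P p := by
    intro P
    constructor
    · rintro ⟨x, hx, hP⟩
      have : x = p := by ext; omega
      rwa [← this]
    · intro h; exact ⟨p, hp, h⟩
  have eq : ∀ P : Fin n → Prop, (∃ x : Fin n, (x : ℕ) = ii r ∧ P x) ↔ P q := by
    intro P
    constructor
    · rintro ⟨x, hx, hP⟩
      have : x = q := by ext; omega
      rwa [← this]
    · intro h; exact ⟨q, hq, h⟩
  rw [q_eq ii hii ((r : ℕ) + 1) ((j : ℕ) + 1) (by have : (r : ℕ) ≤ j := hr; omega) j.2]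
  simp only [ep, eq]
  have hz : ∀ (s : Finset (Fin n)) (F : Fin n → ℤ), ∏ x ∈ s, t r ^ F x = t r ^ ∑ x ∈ s, F x := by
    intro s F
    induction s using Finset.induction_on with
    | empty => simp
    | insert a s ha ih => rw [Finset.prod_insert ha, Finset.sum_insert ha, ih, zpow_add₀ h0]
  rw [hz, Finset.sum_sub_distrib]
  congr 1
  have s1 := sum_ind (i := ii j) (Wn n (iN ii) (fun _ => False) ((j : ℕ) + 1))
    (Wn n (iN ii) (fun _ => False) ((r : ℕ) + 1)) p
  have s2 := sum_ind (i := ii j) (Wn n (iN ii) (fun _ => False) ((j : ℕ) + 1))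
    (Wn n (iN ii) (fun _ => False) ((r : ℕ) + 1)) q
  have hfin : ∀ a b a' b' : ℤ, a = 1 - a' → b = 1 - b' → a - b = -(a' - b') := by
    intros; omega
  apply hfin
  · convert s1
  · convert s2

end helpers

/-- left twist Chamber Ansatz, inverse form (Theorem 2.14, eq. (2.16), type A).
Here `j : Fin m` is the 0-based version of the 1-based index `j+1`; the 1-based condition
`q'_{j,r}(i_r) ≤ i_j` is expressed as `∃ x, (x:ℕ)+1 = i_r ∧ (q'_{j,r} x : ℕ) < i_j`. -/
theorem statement_18 {n m : ℕ} (hn : 1 ≤ n) (ii : Fin m → ℕ)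
    (hii : ∀ r, 1 ≤ ii r ∧ ii r < n)
    (w : Equiv.Perm (Fin n)) (hw : w = (sPermList n ii).prod) (hred : len w = m)
    (v : Equiv.Perm (Fin n)) (hv0 : vseq ii v m = 1)
    (t : Fin m → ℂ) (ht : ∀ r, inJ ii v r → t r ≠ 0)
    (gc : Matrix (Fin n) (Fin n) ℂ) (hgcdet : gc.det = 1)
    (hgc1 : IsN (gc * (pdot v : Matrix (Fin n) (Fin n) ℂ)⁻¹))
    (hgc2 : IsN ((pdot v : Matrix (Fin n) (Fin n) ℂ)⁻¹ * gc))
    (hgc3 : ∃ b : Matrix (Fin n) (Fin n) ℂ, IsBm b ∧ gc = mrg ii v t * b) :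
    (∃ d e f, LDU ((wMR n ii : Matrix (Fin n) (Fin n) ℂ) * gcᵀ) d e f) ∧
    ∀ d e f, LDU ((wMR n ii : Matrix (Fin n) (Fin n) ℂ) * gcᵀ) d e f →
      ∀ j : Fin m,
        minor f
          ((univ.filter fun x : Fin n => ii j ≤ (x : ℕ)).image
            ⇑(((sPermList n ii).take ((j : ℕ) + 1)).prod))
          ((univ.filter fun x : Fin n => ii j ≤ (x : ℕ)).image
            ⇑(((svPermList ii v).take ((j : ℕ) + 1)).prod))
        =
        ∏ r ∈ univ.filter (fun r : Fin m => inJ ii v r ∧ r ≤ j),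
          t r ^
            (-((if ∃ x : Fin n, (x : ℕ) + 1 = ii r ∧
                   ((((((sPermList n ii).take ((j : ℕ) + 1)).drop ((r : ℕ) + 1)).reverse.prod))
                      x : ℕ) < ii j
                then (1 : ℤ) else 0)
              - (if ∃ x : Fin n, (x : ℕ) = ii r ∧
                   ((((((sPermList n ii).take ((j : ℕ) + 1)).drop ((r : ℕ) + 1)).reverse.prod))
                      x : ℕ) < ii j
                then (1 : ℤ) else 0))) := by
  have hi : ∀ k < m, 1 ≤ iN ii k ∧ iN ii k < n := by
    intro k hk
    have := hii ⟨k, hk⟩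
    rwa [← iN_eq ii ⟨k, hk⟩] at this
  have ht' : ∀ k < m, JN ii v k → tN t k ≠ 0 := by
    rintro k hk ⟨_, hJ⟩
    have := ht ⟨k, hk⟩ hJ
    rwa [← tN_eq t ⟨k, hk⟩] at this
  have hwm : w = Wn n (iN ii) (fun _ => False) m := by
    rw [hw, ← take_s ii m le_rfl, List.take_of_length_le (by simp [sPermList])]
  have hW := red_lt ii hii (by rw [← hwm]; exact hred)
  have hV := v_lt ii v hii hv0
  obtain ⟨b, ⟨hbd, hbl⟩, hgb⟩ := hgc3
  rw [mrg_eq] at hgb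
  have hb0 : b.det ≠ 0 := by rw [hbd]; exact one_ne_zero
  rw [wMR_eq ii (tN t)]
  have hXT : (Gn n (iN ii) (fun _ => False) (tN t) m * gcᵀ)ᵀ =
      Gn n (iN ii) (JN ii v) (tN t) m * b * (Gn n (iN ii) (fun _ => False) (tN t) m)ᵀ := by
    rw [Matrix.transpose_mul, Matrix.transpose_transpose, hgb]
  constructor
  · have hQ := Qp_base (iN ii) (JN ii v) (tN t) hi b 1 hbl hb0
      (fun a c h => Matrix.one_apply_ne h.ne') _ rfl
    obtain ⟨γ, g1, g2, g3⟩ := Qp_all _ _ _ _ hi ht' hW hQ 0 (Nat.zero_le _)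
    rw [mul_one, ← hXT] at g3
    refine LDU_exists _ γ _ ?_ g1 g2 ?_ rfl
    · rw [Matrix.det_mul, det_Gn _ _ hi m le_rfl, Matrix.det_transpose, hgcdet, mul_one]
    · intro a b hab
      exact g3 a b hab
  · rintro d e f ⟨hd, he, hf, hX⟩ j
    have hU1 : ∀ a c, c < a → (eᵀ * dᵀ) a c = 0 := by
      intro a c hac
      rw [Matrix.mul_apply]
      apply Finset.sum_eq_zero
      intro x _
      by_cases hx : x = a
      · subst hx; rw [Matrix.transpose_apply d, hd.2 _ _ hac, mul_zero]
      · rw [Matrix.transpose_apply e, he.2 _ _ hx, zero_mul]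
    have hU2 : (eᵀ * dᵀ).det ≠ 0 := by
      rw [Matrix.det_mul, Matrix.det_transpose, Matrix.det_transpose, he.1,
        det_lower_lift d id Function.injective_id hd.2]
      simp [hd.1]
    have hz : fᵀ = Gn n (iN ii) (JN ii v) (tN t) m * b *
        (Gn n (iN ii) (fun _ => False) (tN t) m)ᵀ * (eᵀ * dᵀ)⁻¹ := by
      rw [← hXT, hX, Matrix.transpose_mul, Matrix.transpose_mul, mul_assoc,
        Matrix.mul_nonsing_inv _ (isUnit_iff_ne_zero.mpr hU2), mul_one]
    have hQ := Qp_base (iN ii) (JN ii v) (tN t) hi b _ hbl hb0 (upper_inv _ hU1 hU2) _ hz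
    rw [take_s ii _ j.2, take_sv ii v _ j.2]
    have := minor_eval (iN ii) (JN ii v) (tN t) fᵀ hi ht' hW hV (fun a b h => hf.2 _ _ h)
      (fun a => hf.1 a) hQ ((j : ℕ) + 1) j.2
      (univ.filter fun x : Fin n => ii j ≤ (x : ℕ)) (by
        intro a ha b hab
        simp only [mem_filter, mem_univ, true_and, Fin.lt_def] at *
        omega)
    rw [Matrix.transpose_transpose] at this
    rw [this]
    exact prod_Tdiag ii v t hii ht j

end
end Paper
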